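/- arXiv:math/0610193 — 2 statements merged into one kernel-verified Lean document; each statement's English description precedes it below -/
import Mathlib

section
/- Let n ≥ 6, let U ⊂ {1, ..., n} with |U| = m, 3 ≤ m ≤ n/2 and n - m ≥ 4, and let p, q, r, s ∈ {1, ..., n} \ U be distinct. Let u be the degree-1 polynomial u(x) = x_{pq} - x_{qr} + x_{rs} - x_{sp}. Then for every polynomial w of degree at most 1 on ℝ^{n(n-1)/2}, (1/|X|) Σ_{x∈X} h_U(x) u(x) w(x) = (2(n-m-2)/((n-2)(n-m-1))) ⟨u, w⟩, where ⟨·,·⟩ is the inner product making the monomial basis {1} ∪ {x_{st} : 1 ≤ s < t ≤ n} orthonormal; i.e., u is an eigenvector of the matrix of the quadratic form q_{h_U} with eigenvalue 2(n-m-2)/((n-2)(n-m-1)). -/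
open Finset
noncomputable section
open scoped Classical

/-- Index type for the coordinates of `ℝ^{n(n-1)/2}`: unordered pairs of distinct
vertices of the complete graph `K_n` on `Fin n`. -/
abbrev EdgeIdx (n : ℕ) := {e : Sym2 (Fin n) // ¬ e.IsDiag}

/-- The incidence vector of the Hamiltonian cycle of `K_n` determined by a
permutation `σ` of the vertices (the cycle visiting `σ 0, σ 1, …, σ (n-1)` in order). -/
def cycleVec (n : ℕ) (σ : Equiv.Perm (Fin n)) : EdgeIdx n → ℝ :=
  fun e => if ∃ i : Fin n, (e : Sym2 (Fin n)) = s(σ i, σ (finRotate n i)) then 1 else 0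

/-- `X`, the (finite) set of incidence vectors of Hamiltonian cycles of `K_n`. -/
def hamX (n : ℕ) : Finset (EdgeIdx n → ℝ) := Finset.image (cycleVec n) Finset.univ

/-- The entry `x_{ij}` of a vector `x : EdgeIdx n → ℝ` at the unordered pair `{i,j}`
(conventionally `0` if `i = j`). -/
def xval {n : ℕ} (x : EdgeIdx n → ℝ) (i j : Fin n) : ℝ :=
  if h : i = j then 0 else x ⟨s(i, j), by simpa [Sym2.isDiag_iff_proj_eq] using h⟩

/-- The subtour elimination function `h_U(x) = c (Σ_{u∈U, v∉U} x_{uv} - 2)` with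
`c = (n-1)/(2(m(n-m)+1-n))`, where `m = |U|` (so that `h_U` has average value `1`
on `X`). -/
def hU {n : ℕ} (U : Finset (Fin n)) (x : EdgeIdx n → ℝ) : ℝ :=
  (((n : ℝ) - 1) / (2 * ((U.card : ℝ) * ((n : ℝ) - (U.card : ℝ)) + 1 - (n : ℝ)))) *
    ((∑ u ∈ U, ∑ v ∈ Uᶜ, xval x u v) - 2)

/-- Coefficient vector (in the monomial basis `{x_{pq}}`) of the degree-1 polynomial
`x_{ab} - x_{bc} + x_{cd} - x_{da}` for distinct vertices `a, b, c, d`. -/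
def quadCoef {n : ℕ} (a b c d : Fin n) : EdgeIdx n → ℝ := fun e =>
  (if (e : Sym2 (Fin n)) = s(a, b) then 1 else 0)
    - (if (e : Sym2 (Fin n)) = s(b, c) then 1 else 0)
    + (if (e : Sym2 (Fin n)) = s(c, d) then 1 else 0)
    - (if (e : Sym2 (Fin n)) = s(d, a) then 1 else 0)

lemma val_finRotate {n : ℕ} (i : Fin n) :
    (finRotate n i).val = if i.val + 1 = n then 0 else i.val + 1 := by
  obtain _ | k := n
  · exact i.elim0
  · rw [coe_finRotate]
    simp only [Fin.ext_iff, Fin.val_last]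
    split_ifs <;> omega

lemma xval_self {n : ℕ} (x : EdgeIdx n → ℝ) (a : Fin n) : xval x a a = 0 := by
  simp [xval]

lemma xval_comm {n : ℕ} (x : EdgeIdx n → ℝ) (a b : Fin n) : xval x a b = xval x b a := by
  unfold xval
  by_cases h : a = b
  · simp [h]
  · simp only [h, Ne.symm h, dite_false]
    congr 2
    exact Sym2.eq_swap

lemma xval_congr {n : ℕ} (x : EdgeIdx n → ℝ) {a b c d : Fin n} (h : s(a, b) = s(c, d)) :
    xval x a b = xval x c d := by
  rcases Sym2.eq_iff.1 h with ⟨rfl, rfl⟩ | ⟨rfl, rfl⟩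
  · rfl
  · exact xval_comm x _ _

/-- A Hamiltonian cycle is described by its successor permutation, which has no orbit of
length at most three as soon as there are four vertices. -/
lemma exists_successor {n : ℕ} (hn : 4 ≤ n) {x : EdgeIdx n → ℝ} (hx : x ∈ hamX n) :
    ∃ ρ : Equiv.Perm (Fin n), (∀ a, ρ a ≠ a) ∧ (∀ a, ρ (ρ a) ≠ a) ∧
      (∀ a, ρ (ρ (ρ a)) ≠ a) ∧
      ∀ a b, xval x a b = if b = ρ a ∨ a = ρ b then 1 else 0 := by
  obtain ⟨σ, -, rfl⟩ := Finset.mem_image.1 hx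
  have h1 : ∀ i, finRotate n i ≠ i := fun i h => by
    have := congrArg Fin.val h
    rw [val_finRotate] at this
    split_ifs at this <;> omega
  have h2 : ∀ i, finRotate n (finRotate n i) ≠ i := fun i h => by
    have := congrArg Fin.val h
    simp only [val_finRotate] at this
    split_ifs at this <;> omega
  have h3 : ∀ i, finRotate n (finRotate n (finRotate n i)) ≠ i := fun i h => by
    have := congrArg Fin.val h
    simp only [val_finRotate] at this
    split_ifs at this <;> omega
  refine ⟨(σ.symm.trans (finRotate n)).trans σ, fun a h => h1 (σ.symm a) ?_,
    fun a h => h2 (σ.symm a) ?_, fun a h => h3 (σ.symm a) ?_, fun a b => ?_⟩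
  · simpa [Equiv.eq_symm_apply] using h
  · simpa [Equiv.eq_symm_apply] using h
  · simpa [Equiv.eq_symm_apply] using h
  · by_cases hab : a = b
    · subst hab
      rw [xval_self, if_neg]
      rintro (h | h) <;> exact h1 (σ.symm a) (by rw [Equiv.eq_symm_apply]; exact h.symm)
    · simp only [xval, hab, dite_false, cycleVec]
      refine if_congr ⟨?_, ?_⟩ rfl rfl
      · rintro ⟨i, hi⟩
        rcases Sym2.eq_iff.1 hi with ⟨rfl, rfl⟩ | ⟨rfl, rfl⟩
        · left; simp
        · right; simp
      · rintro (h | h)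
        · exact ⟨σ.symm a, by rw [h, Equiv.apply_symm_apply]; rfl⟩
        · exact ⟨σ.symm b, by rw [h, Equiv.apply_symm_apply, Sym2.eq_swap]; rfl⟩

lemma xval_mul_self {n : ℕ} (hn : 4 ≤ n) {x : EdgeIdx n → ℝ} (hx : x ∈ hamX n) (a b : Fin n) :
    xval x a b * xval x a b = xval x a b := by
  obtain ⟨ρ, -, -, -, h⟩ := exists_successor hn hx
  rw [h]
  split_ifs <;> simp

lemma sum_xval {n : ℕ} (hn : 4 ≤ n) {x : EdgeIdx n → ℝ} (hx : x ∈ hamX n) (a : Fin n) :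
    ∑ b, xval x a b = 2 := by
  obtain ⟨ρ, -, h2, -, h⟩ := exists_successor hn hx
  have key : ∀ b, xval x a b = (if b = ρ a then 1 else 0) + (if b = ρ.symm a then 1 else 0) := by
    intro b
    have hb : a = ρ b ↔ b = ρ.symm a := by rw [Equiv.eq_symm_apply, eq_comm]
    have hne : ρ a ≠ ρ.symm a := fun e => h2 a (by rw [e, Equiv.apply_symm_apply])
    rw [h]
    simp only [hb]
    by_cases h3 : b = ρ a
    · simp [h3, hne]
    · simp [h3]
  simp only [key, Finset.sum_add_distrib, Finset.sum_ite_eq', Finset.mem_univ, if_true]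
  norm_num

lemma xval_triangle {n : ℕ} (hn : 4 ≤ n) {x : EdgeIdx n → ℝ} (hx : x ∈ hamX n)
    (a b c : Fin n) : xval x a b * xval x b c * xval x c a = 0 := by
  obtain ⟨ρ, h1, h2, h3, h⟩ := exists_successor hn hx
  simp only [h]
  have := h1 a; have := h1 b; have := h1 c
  have := h2 a; have := h2 b; have := h2 c
  have := h3 a; have := h3 b; have := h3 c
  split_ifs <;> grind [ρ.injective.eq_iff]

lemma xval_star {n : ℕ} (hn : 4 ≤ n) {x : EdgeIdx n → ℝ} (hx : x ∈ hamX n)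
    {a b c d : Fin n} (hbc : b ≠ c) (hbd : b ≠ d) (hcd : c ≠ d) :
    xval x a b * xval x a c * xval x a d = 0 := by
  obtain ⟨ρ, -, -, -, h⟩ := exists_successor hn hx
  simp only [h]
  split_ifs <;> grind [ρ.injective.eq_iff]

/-- The vector obtained from `x` by renaming the vertices along `τ`. -/
def relabel {n : ℕ} (τ : Equiv.Perm (Fin n)) (x : EdgeIdx n → ℝ) : EdgeIdx n → ℝ :=
  fun e => x ⟨Sym2.map τ e, fun h => e.2 ((Sym2.isDiag_map τ.injective).1 h)⟩

lemma xval_relabel {n : ℕ} (τ : Equiv.Perm (Fin n)) (x : EdgeIdx n → ℝ) (a b : Fin n) :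
    xval (relabel τ x) a b = xval x (τ a) (τ b) := by
  simp [xval, relabel]

lemma relabel_mem_hamX {n : ℕ} (τ : Equiv.Perm (Fin n)) {x : EdgeIdx n → ℝ}
    (hx : x ∈ hamX n) : relabel τ x ∈ hamX n := by
  obtain ⟨σ, -, rfl⟩ := Finset.mem_image.1 hx
  refine Finset.mem_image.2 ⟨τ⁻¹ * σ, Finset.mem_univ _, ?_⟩
  funext e
  refine if_congr (exists_congr fun i => ?_) rfl rfl
  rw [← (Sym2.map.injective τ.injective).eq_iff]
  simp

lemma relabel_relabel_symm {n : ℕ} (τ : Equiv.Perm (Fin n)) (x : EdgeIdx n → ℝ) :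
    relabel τ (relabel τ.symm x) = x := by
  funext e
  simp only [relabel, Sym2.map_map]
  congr
  simp

lemma sum_hamX_relabel {n : ℕ} (τ : Equiv.Perm (Fin n)) (f : (EdgeIdx n → ℝ) → ℝ) :
    ∑ x ∈ hamX n, f (relabel τ x) = ∑ x ∈ hamX n, f x :=
  Finset.sum_nbij' (relabel τ) (relabel τ.symm) (fun _ => relabel_mem_hamX τ)
    (fun _ => relabel_mem_hamX τ.symm) (fun x _ => relabel_relabel_symm τ.symm x)
    (fun x _ => relabel_relabel_symm τ x) (fun _ _ => rfl)

/-- Sums over all Hamiltonian cycles do not depend on the names of the vertices involved. -/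
lemma sum_hamX_rename {n k : ℕ} {f g : Fin k → Fin n} (hf : Function.Injective f)
    (hg : Function.Injective g) (F : (Fin k → Fin k → ℝ) → ℝ) :
    ∑ x ∈ hamX n, F (fun i j => xval x (f i) (f j)) =
      ∑ x ∈ hamX n, F (fun i j => xval x (g i) (g j)) := by
  obtain ⟨τ, hτ⟩ := (Equiv.Perm.isMultiplyPretransitive (Fin n) k).exists_smul_eq
    ⟨f, hf⟩ ⟨g, hg⟩
  have hτ' : ∀ i, τ (f i) = g i := fun i => DFunLike.congr_fun hτ i
  rw [← sum_hamX_relabel τ (fun x => F (fun i j => xval x (f i) (f j)))]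
  simp only [xval_relabel, hτ']

lemma injective_vec_three {n : ℕ} {a b c : Fin n} (hab : a ≠ b) (hac : a ≠ c) (hbc : b ≠ c) :
    Function.Injective ![a, b, c] := by
  intro i j
  fin_cases i <;> fin_cases j <;> simp [*, Ne.symm]

lemma sum_univ_of_eq_off {n : ℕ} (T : Finset (Fin n)) (F : Fin n → ℝ) (K : ℝ)
    (h : ∀ v ∉ T, F v = K) : ∑ v, F v = ∑ v ∈ T, F v + ((n : ℝ) - T.card) * K := by
  rw [← Finset.sum_add_sum_compl T F,
    Finset.sum_congr rfl (fun v hv => h v (Finset.mem_compl.1 hv)), Finset.sum_const,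
    Finset.card_compl, Fintype.card_fin, nsmul_eq_mul,
    Nat.cast_sub ((Finset.card_le_univ T).trans_eq (Fintype.card_fin n))]

lemma sum_edge {n : ℕ} (hn : 4 ≤ n) {a b : Fin n} (hab : a ≠ b) :
    ((n : ℝ) - 1) * ∑ x ∈ hamX n, xval x a b = 2 * (hamX n).card := by
  have h := sum_univ_of_eq_off {a} (fun v => ∑ x ∈ hamX n, xval x a v)
    (∑ x ∈ hamX n, xval x a b) (fun v hv => by
      have hva : a ≠ v := fun e => hv (by simp [e])
      simpa using sum_hamX_rename (f := ![a, v]) (g := ![a, b])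
        (by intro i j; fin_cases i <;> fin_cases j <;> simp [hva, hva.symm])
        (by intro i j; fin_cases i <;> fin_cases j <;> simp [hab, hab.symm])
        (fun y => y 0 1))
  rw [Finset.sum_comm, Finset.sum_congr rfl (fun x hx => sum_xval hn hx a)] at h
  simp only [Finset.sum_const, nsmul_eq_mul, Finset.sum_singleton, xval_self,
    Finset.card_singleton] at h
  push_cast at h
  linarith

lemma sum_adjacent_edges {n : ℕ} (hn : 4 ≤ n) {a b c : Fin n} (hab : a ≠ b) (hac : a ≠ c)
    (hbc : b ≠ c) :
    ((n : ℝ) - 2) * ∑ x ∈ hamX n, xval x a b * xval x b c = ∑ x ∈ hamX n, xval x a b := by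
  have h := sum_univ_of_eq_off {a, b} (fun v => ∑ x ∈ hamX n, xval x a b * xval x b v)
    (∑ x ∈ hamX n, xval x a b * xval x b c) (fun v hv => by
      simp only [Finset.mem_insert, Finset.mem_singleton, not_or] at hv
      simpa using sum_hamX_rename (f := ![a, b, v]) (g := ![a, b, c])
        (injective_vec_three hab (Ne.symm hv.1) (Ne.symm hv.2))
        (injective_vec_three hab hac hbc) (fun y => y 0 1 * y 1 2))
  have haa : ∑ x ∈ hamX n, xval x a b * xval x b a = ∑ x ∈ hamX n, xval x a b :=
    Finset.sum_congr rfl fun x hx => by rw [xval_comm x b a, xval_mul_self hn hx]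
  rw [Finset.sum_comm, Finset.sum_congr rfl
    (fun x hx => by rw [← Finset.mul_sum, sum_xval hn hx b]), ← Finset.sum_mul,
    Finset.sum_pair hab, Finset.card_pair hab, haa] at h
  simp only [xval_self, mul_zero, Finset.sum_const_zero] at h
  push_cast at h
  linarith

lemma injective_vec_four {n : ℕ} {a b c d : Fin n} (hab : a ≠ b) (hac : a ≠ c) (had : a ≠ d)
    (hbc : b ≠ c) (hbd : b ≠ d) (hcd : c ≠ d) : Function.Injective ![a, b, c, d] := by
  intro i j
  fin_cases i <;> fin_cases j <;> simp [*, Ne.symm]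

lemma sum_disjoint_edges {n : ℕ} (hn : 4 ≤ n) {a b c d : Fin n} (hab : a ≠ b) (hac : a ≠ c)
    (had : a ≠ d) (hbc : b ≠ c) (hbd : b ≠ d) (hcd : c ≠ d) :
    ((n : ℝ) - 2) * ∑ x ∈ hamX n, xval x a b * xval x c d =
      2 * ∑ x ∈ hamX n, xval x a b := by
  have h := sum_univ_of_eq_off {a, b, c} (fun v => ∑ x ∈ hamX n, xval x a b * xval x c v)
    (∑ x ∈ hamX n, xval x a b * xval x c d) (fun v hv => by
      simp only [Finset.mem_insert, Finset.mem_singleton, not_or] at hv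
      obtain ⟨hva, hvb, hvc⟩ := hv
      simpa using sum_hamX_rename (f := ![a, b, c, v]) (g := ![a, b, c, d])
        (injective_vec_four hab hac (Ne.symm hva) hbc (Ne.symm hvb) (Ne.symm hvc))
        (injective_vec_four hab hac had hbc hbd hcd) (fun y => y 0 1 * y 2 3))
  have hb := sum_adjacent_edges hn hab hac hbc
  have ha := sum_adjacent_edges hn hab.symm hbc hac
  simp only [xval_comm _ b a] at ha
  rw [Finset.sum_comm, Finset.sum_congr rfl
    (fun x hx => by rw [← Finset.mul_sum, sum_xval hn hx c]), ← Finset.sum_mul,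
    Finset.sum_insert (by simp [hab, hac]), Finset.sum_pair hbc,
    Finset.card_eq_three.2 ⟨a, b, c, hab, hac, hbc, rfl⟩] at h
  simp only [xval_self, mul_zero, Finset.sum_const_zero, xval_comm _ c a, xval_comm _ c b] at h
  push_cast at h
  have h4 : (4 : ℝ) ≤ n := by exact_mod_cast hn
  have h3 : (n : ℝ) - 3 ≠ 0 := by linarith
  apply mul_left_cancel₀ h3
  linear_combination (2 - (n : ℝ)) * h - ha - hb

/-- The edges leaving `A`, counted through the degrees of the vertices of `A`. -/
lemma sum_cut {n : ℕ} (hn : 4 ≤ n) {x : EdgeIdx n → ℝ} (hx : x ∈ hamX n)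
    (A : Finset (Fin n)) :
    ∑ a ∈ A, ∑ b ∈ Aᶜ, xval x a b = 2 * A.card - ∑ a ∈ A, ∑ b ∈ A, xval x a b := by
  rw [eq_sub_iff_add_eq, ← Finset.sum_add_distrib, Finset.sum_congr rfl (fun a _ => by
    rw [add_comm, Finset.sum_add_sum_compl, sum_xval hn hx a])]
  simp [mul_comm]

/-- The edges avoiding four vertices, counted through the edges between these vertices. -/
lemma sum_avoiding_four {n : ℕ} (hn : 4 ≤ n) {x : EdgeIdx n → ℝ} (hx : x ∈ hamX n)
    {p q r s : Fin n} (hpq : p ≠ q) (hpr : p ≠ r) (hps : p ≠ s) (hqr : q ≠ r) (hqs : q ≠ s)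
    (hrs : r ≠ s) :
    ∑ a ∈ ({p, q, r, s} : Finset (Fin n))ᶜ, ∑ b ∈ ({p, q, r, s} : Finset (Fin n))ᶜ, xval x a b =
      2 * (n - 8 + (xval x p q + xval x p r + xval x p s + xval x q r + xval x q s
        + xval x r s)) := by
  have hcard : ({p, q, r, s} : Finset (Fin n)).card = 4 := by simp [*]
  have h1 := sum_cut hn hx ({p, q, r, s} : Finset (Fin n))
  have h2 := sum_cut hn hx ({p, q, r, s} : Finset (Fin n))ᶜ
  rw [compl_compl, Finset.sum_comm] at h2
  simp only [fun a b => xval_comm x b a] at h2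
  have h3 : ∑ a ∈ ({p, q, r, s} : Finset (Fin n)), ∑ b ∈ ({p, q, r, s} : Finset (Fin n)),
      xval x a b = 2 * (xval x p q + xval x p r + xval x p s + xval x q r + xval x q s
        + xval x r s) := by
    have e : ∀ f : Fin n → ℝ, ∑ a ∈ ({p, q, r, s} : Finset (Fin n)), f a =
        f p + f q + f r + f s := fun f => by
      rw [Finset.sum_insert (by simp [*]), Finset.sum_insert (by simp [*]), Finset.sum_pair hrs]
      ring
    simp only [e, xval_self, xval_comm x q p, xval_comm x r p, xval_comm x s p,
      xval_comm x r q, xval_comm x s q, xval_comm x s r]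
    ring
  rw [Finset.card_compl, Fintype.card_fin, hcard, Nat.cast_sub hn] at h2
  rw [hcard] at h1
  push_cast at h1 h2
  linarith

lemma sum_offDiag_const {n : ℕ} (A : Finset (Fin n)) (F : Fin n → Fin n → ℝ) (K : ℝ)
    (h0 : ∀ a, F a a = 0) (hK : ∀ a ∈ A, ∀ b ∈ A, a ≠ b → F a b = K) :
    ∑ a ∈ A, ∑ b ∈ A, F a b = A.card * (A.card - 1) * K := by
  have h : ∀ a ∈ A, ∑ b ∈ A, F a b = (A.card - 1) * K := fun a ha => by
    rw [← Finset.add_sum_erase A _ ha, h0, zero_add, Finset.sum_congr rfl (fun b hb =>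
      hK a ha b (Finset.mem_of_mem_erase hb) (Finset.ne_of_mem_erase hb).symm),
      Finset.sum_const, nsmul_eq_mul, Finset.card_erase_of_mem ha,
      Nat.cast_sub (Finset.card_pos.2 ⟨a, ha⟩), Nat.cast_one]
  rw [Finset.sum_congr rfl h, Finset.sum_const, nsmul_eq_mul, mul_assoc]

/-- The value at `x` of the polynomial `x_{pq} - x_{qr} + x_{rs} - x_{sp}`. -/
def quadVal {n : ℕ} (p q r s : Fin n) (x : EdgeIdx n → ℝ) : ℝ :=
  xval x p q - xval x q r + xval x r s - xval x s p

lemma sum_edge_quadVal {n : ℕ} (hn : 4 ≤ n) {p q r s : Fin n} (hpq : p ≠ q) (hpr : p ≠ r)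
    (hps : p ≠ s) (hqr : q ≠ r) (hqs : q ≠ s) (hrs : r ≠ s) :
    ∑ x ∈ hamX n, xval x p q * quadVal p q r s x = ∑ x ∈ hamX n, xval x p q := by
  have h4 : (4 : ℝ) ≤ n := by exact_mod_cast hn
  have hq := sum_adjacent_edges hn hpq hpr hqr
  have hp := sum_adjacent_edges hn hpq.symm hqs hps
  have hd := sum_disjoint_edges hn hpq hpr hps hqr hqs hrs
  have e : ∑ x ∈ hamX n, xval x p q * quadVal p q r s x =
      ∑ x ∈ hamX n, xval x p q - ∑ x ∈ hamX n, xval x p q * xval x q r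
        + ∑ x ∈ hamX n, xval x p q * xval x r s - ∑ x ∈ hamX n, xval x q p * xval x p s := by
    simp only [← Finset.sum_sub_distrib, ← Finset.sum_add_distrib]
    refine Finset.sum_congr rfl fun x hx => ?_
    rw [quadVal, xval_comm x q p, xval_comm x s p]
    linear_combination xval_mul_self hn hx p q
  have h2 : (n : ℝ) - 2 ≠ 0 := by linarith
  rw [e]
  apply mul_left_cancel₀ h2
  simp only [xval_comm _ q p] at hp ⊢
  linear_combination hd - hq - hp

lemma sum_edge_quadVal_inner {n : ℕ} (hn : 4 ≤ n) {p q r s : Fin n} (hpq : p ≠ q) (hpr : p ≠ r)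
    (hps : p ≠ s) (hqr : q ≠ r) (hqs : q ≠ s) (hrs : r ≠ s) :
    ((n : ℝ) - 2) * ∑ x ∈ hamX n, xval x p q * quadVal p q r s x *
        (xval x p q + xval x p r + xval x p s + xval x q r + xval x q s + xval x r s) =
      ((n : ℝ) + 4) * ∑ x ∈ hamX n, xval x p q := by
  have rename : ∀ {a b c d : Fin n} (_ : Function.Injective ![a, b, c, d]),
      ∑ x ∈ hamX n, xval x a b * xval x b c * xval x c d =
        ∑ x ∈ hamX n, xval x p q * xval x q r * xval x r s := fun h => by
    simpa using sum_hamX_rename h (injective_vec_four hpq hpr hps hqr hqs hrs)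
      (fun y => y 0 1 * y 1 2 * y 2 3)
  have adj : ∀ {a b c : Fin n} (_ : Function.Injective ![a, b, c]),
      ∑ x ∈ hamX n, xval x a b * xval x b c =
        ∑ x ∈ hamX n, xval x p q * xval x q r := fun h => by
    simpa using sum_hamX_rename h (injective_vec_three hpq hpr hqr)
      (fun y => y 0 1 * y 1 2)
  have hd := sum_disjoint_edges hn hpq hpr hps hqr hqs hrs
  have a1 := adj (injective_vec_three hpr.symm hqr.symm hpq)
  have a2 := adj (injective_vec_three hps.symm hqs.symm hpq)
  have a3 := adj (injective_vec_three hpq hps hqs)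
  have t1 := rename (injective_vec_four hpq hps hpr hqs hqr hrs.symm)
  have t2 := rename (injective_vec_four hpq.symm hqr hqs hpr hps hrs)
  have t3 := rename (injective_vec_four hqr.symm hpr.symm hrs hpq.symm hqs hps)
  have e : ∑ x ∈ hamX n, xval x p q * quadVal p q r s x *
        (xval x p q + xval x p r + xval x p s + xval x q r + xval x q s + xval x r s) =
      ∑ x ∈ hamX n, xval x p q + 3 * ∑ x ∈ hamX n, xval x p q * xval x r s
      + ∑ x ∈ hamX n, xval x r p * xval x p q - ∑ x ∈ hamX n, xval x s p * xval x p q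
      - ∑ x ∈ hamX n, xval x p q * xval x q r + ∑ x ∈ hamX n, xval x p q * xval x q s
      + ∑ x ∈ hamX n, xval x p q * xval x q s * xval x s r
      + ∑ x ∈ hamX n, xval x q p * xval x p r * xval x r s
      - 2 * ∑ x ∈ hamX n, xval x r q * xval x q p * xval x p s := by
    simp only [Finset.mul_sum, ← Finset.sum_sub_distrib, ← Finset.sum_add_distrib]
    refine Finset.sum_congr rfl fun x hx => ?_
    have c1 := xval_triangle hn hx p q r
    have c2 := xval_triangle hn hx p q s
    have c3 := xval_star hn hx (a := q) hpr hps hrs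
    have c4 := xval_star hn hx (a := p) hqr hqs hrs
    have i1 := xval_mul_self hn hx p q
    have i2 := xval_mul_self hn hx q r
    have i3 := xval_mul_self hn hx r s
    have i4 := xval_mul_self hn hx p s
    simp only [quadVal, xval_comm x q p, xval_comm x r p, xval_comm x s p,
      xval_comm x r q, xval_comm x s r] at *
    linear_combination (xval x p q + xval x p r + xval x p s + xval x q r + xval x q s
      + xval x r s + 1) * i1 + (xval x r s - xval x p s - xval x q r) * i1
      - xval x p q * i2 + xval x p q * i3 - xval x p q * i4 - c1 - c2 - c3 - c4
  rw [e, a1, a2, a3, t1, t2, t3]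
  linear_combination 3 * hd

lemma injective_vec_six {n : ℕ} {a b c d e f : Fin n}
    (habcd : Function.Injective ![a, b, c, d]) (hef : e ≠ f)
    (he : e ∉ ({a, b, c, d} : Finset (Fin n))) (hf : f ∉ ({a, b, c, d} : Finset (Fin n))) :
    Function.Injective ![a, b, c, d, e, f] := by
  have h01 : a ≠ b := habcd.ne (show (0 : Fin 4) ≠ 1 by decide)
  have h02 : a ≠ c := habcd.ne (show (0 : Fin 4) ≠ 2 by decide)
  have h03 : a ≠ d := habcd.ne (show (0 : Fin 4) ≠ 3 by decide)
  have h12 : b ≠ c := habcd.ne (show (1 : Fin 4) ≠ 2 by decide)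
  have h13 : b ≠ d := habcd.ne (show (1 : Fin 4) ≠ 3 by decide)
  have h23 : c ≠ d := habcd.ne (show (2 : Fin 4) ≠ 3 by decide)
  simp only [Finset.mem_insert, Finset.mem_singleton, not_or] at he hf
  obtain ⟨hea, heb, hec, hed⟩ := he
  obtain ⟨hfa, hfb, hfc, hfd⟩ := hf
  intro i j
  fin_cases i <;> fin_cases j <;> simp [*, Ne.symm]

lemma sum_cut_edge_quadVal {n : ℕ} {U : Finset (Fin n)} (hm : 1 < U.card) {p q r s : Fin n}
    (hpU : p ∉ U) (hqU : q ∉ U) (hrU : r ∉ U) (hsU : s ∉ U)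
    (hpq : p ≠ q) (hpr : p ≠ r) (hps : p ≠ s)
    (hqr : q ≠ r) (hqs : q ≠ s) (hrs : r ≠ s) :
    ((n : ℝ) - 2) * ∑ x ∈ hamX n, (∑ u ∈ U, ∑ v ∈ Uᶜ, xval x u v - 2) *
        (xval x p q * quadVal p q r s x) =
      2 * ((U.card : ℝ) - 1) * (n - U.card - 2) * ∑ x ∈ hamX n, xval x p q := by
  obtain ⟨c, hc, d, hd, hcd⟩ := Finset.one_lt_card.1 hm
  set O : Finset (Fin n) := ({p, q, r, s} : Finset (Fin n))ᶜ with hO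
  have hcard4 : ({p, q, r, s} : Finset (Fin n)).card = 4 := by simp [*]
  have hUO : U ⊆ O := fun a ha => by
    simp only [hO, Finset.mem_compl, Finset.mem_insert, Finset.mem_singleton]
    rintro (rfl | rfl | rfl | rfl) <;> contradiction
  have hOcard' : O.card + 4 = n := by
    have := Finset.card_add_card_compl ({p, q, r, s} : Finset (Fin n))
    rw [hcard4, Fintype.card_fin, ← hO] at this
    omega
  have hO2 : 2 ≤ O.card := hm.trans_le (Finset.card_le_card hUO)
  have hn : 4 ≤ n := by omega
  have hOcard : (O.card : ℝ) = n - 4 := by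
    rw [eq_sub_iff_add_eq]
    exact_mod_cast hOcard'
  set K := ∑ x ∈ hamX n, xval x p q * quadVal p q r s x * xval x c d
  have inner : ∀ A ⊆ O, ∑ x ∈ hamX n, xval x p q * quadVal p q r s x *
      ∑ a ∈ A, ∑ b ∈ A, xval x a b = A.card * (A.card - 1) * K := fun A hA => by
    rw [← sum_offDiag_const A
      (fun a b => ∑ x ∈ hamX n, xval x p q * quadVal p q r s x * xval x a b) K
      (fun a => by simp [xval_self])]
    · simp only [Finset.mul_sum]
      rw [Finset.sum_comm]
      exact Finset.sum_congr rfl fun a _ => Finset.sum_comm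
    · intro a ha b hb hab
      have h4 := injective_vec_four hpq hpr hps hqr hqs hrs
      simpa [quadVal, K] using sum_hamX_rename
        (injective_vec_six h4 hab (Finset.mem_compl.1 (hA ha)) (Finset.mem_compl.1 (hA hb)))
        (injective_vec_six h4 hcd (Finset.mem_compl.1 (hUO hc)) (Finset.mem_compl.1 (hUO hd)))
        (fun y => y 0 1 * (y 0 1 - y 1 2 + y 2 3 - y 3 0) * y 4 5)
  have h1 := sum_edge_quadVal hn hpq hpr hps hqr hqs hrs
  have h2 := sum_edge_quadVal_inner hn hpq hpr hps hqr hqs hrs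
  have hOK : 2 * ((n : ℝ) - 8) * ∑ x ∈ hamX n, xval x p q * quadVal p q r s x +
      2 * ∑ x ∈ hamX n, xval x p q * quadVal p q r s x *
        (xval x p q + xval x p r + xval x p s + xval x q r + xval x q s + xval x r s) =
      O.card * (O.card - 1) * K := by
    rw [← inner O subset_rfl, Finset.mul_sum, Finset.mul_sum, ← Finset.sum_add_distrib]
    refine Finset.sum_congr rfl fun x hx => ?_
    rw [sum_avoiding_four hn hx hpq hpr hps hqr hqs hrs]
    ring
  have hUK : ∑ x ∈ hamX n, (∑ u ∈ U, ∑ v ∈ Uᶜ, xval x u v - 2) *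
        (xval x p q * quadVal p q r s x) =
      2 * ((U.card : ℝ) - 1) * ∑ x ∈ hamX n, xval x p q * quadVal p q r s x -
        U.card * (U.card - 1) * K := by
    rw [← inner U hUO, Finset.mul_sum, ← Finset.sum_sub_distrib]
    refine Finset.sum_congr rfl fun x hx => ?_
    rw [sum_cut hn hx]
    ring
  have hK : ((n : ℝ) - 2) * K = 2 * ∑ x ∈ hamX n, xval x p q := by
    have hO2' : (2 : ℝ) ≤ O.card := by exact_mod_cast hO2
    have hne : (O.card : ℝ) * (O.card - 1) ≠ 0 :=
      mul_ne_zero (by linarith) (by linarith)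
    apply mul_left_cancel₀ hne
    rw [h1] at hOK
    rw [hOcard] at hOK ⊢
    linear_combination (2 - (n : ℝ)) * hOK + 2 * h2
  rw [hUK, h1]
  linear_combination -(U.card : ℝ) * (U.card - 1) * hK

lemma hU_relabel_swap {n : ℕ} {U : Finset (Fin n)} {a b : Fin n} (ha : a ∉ U) (hb : b ∉ U)
    (x : EdgeIdx n → ℝ) : hU U (relabel (Equiv.swap a b) x) = hU U x := by
  have h : ∑ u ∈ U, ∑ v ∈ Uᶜ, xval (relabel (Equiv.swap a b) x) u v =
      ∑ u ∈ U, ∑ v ∈ Uᶜ, xval x u v := by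
    refine Finset.sum_congr rfl fun u hu => ?_
    have hua : u ≠ a := fun e => ha (e ▸ hu)
    have hub : u ≠ b := fun e => hb (e ▸ hu)
    refine Finset.sum_equiv (Equiv.swap a b) (fun v => ?_) (fun v _ => ?_)
    · by_cases hva : v = a
      · simp [hva, ha, hb]
      · by_cases hvb : v = b
        · simp [hvb, ha, hb]
        · rw [Equiv.swap_apply_of_ne_of_ne hva hvb]
    · rw [xval_relabel, Equiv.swap_apply_of_ne_of_ne hua hub]
  rw [hU, h, hU]

lemma quadVal_rotate {n : ℕ} (p q r s : Fin n) (x : EdgeIdx n → ℝ) :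
    quadVal q r s p x = -quadVal p q r s x := by
  simp only [quadVal]
  ring

lemma quadVal_relabel_swap {n : ℕ} {p q r s : Fin n} (hpq : p ≠ q) (hps : p ≠ s)
    (hqr : q ≠ r) (hrs : r ≠ s) (x : EdgeIdx n → ℝ) :
    quadVal p q r s (relabel (Equiv.swap p r) x) = -quadVal p q r s x := by
  simp only [quadVal, xval_relabel, Equiv.swap_apply_left, Equiv.swap_apply_right,
    Equiv.swap_apply_of_ne_of_ne hpq.symm hqr, Equiv.swap_apply_of_ne_of_ne hps.symm hrs.symm,
    xval_comm x r q, xval_comm x q p, xval_comm x p s, xval_comm x s r]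
  ring

/-- Exchanging two opposite corners of the quadrilateral changes the sign of the form. -/
lemma sum_hU_quadVal_swap {n : ℕ} {U : Finset (Fin n)} {p q r s : Fin n}
    (hpU : p ∉ U) (hrU : r ∉ U) (hpq : p ≠ q) (hps : p ≠ s) (hqr : q ≠ r) (hrs : r ≠ s)
    (f : (EdgeIdx n → ℝ) → ℝ) :
    ∑ x ∈ hamX n, hU U x * quadVal p q r s x * f (relabel (Equiv.swap p r) x) =
      -∑ x ∈ hamX n, hU U x * quadVal p q r s x * f x := by
  rw [← sum_hamX_relabel (Equiv.swap p r) (fun x => hU U x * quadVal p q r s x * f x),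
    ← Finset.sum_neg_distrib]
  refine Finset.sum_congr rfl fun x _ => ?_
  rw [hU_relabel_swap hpU hrU, quadVal_relabel_swap hpq hps hqr hrs]
  ring

lemma sum_hU_quadVal_edge {n : ℕ} {U : Finset (Fin n)} (hm : 1 < U.card) {p q r s : Fin n}
    (hpU : p ∉ U) (hqU : q ∉ U) (hrU : r ∉ U) (hsU : s ∉ U)
    (hpq : p ≠ q) (hpr : p ≠ r) (hps : p ≠ s)
    (hqr : q ≠ r) (hqs : q ≠ s) (hrs : r ≠ s) :
    ∑ x ∈ hamX n, hU U x * quadVal p q r s x * xval x p q =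
      2 * ((n : ℝ) - U.card - 2) / ((n - 2) * (n - U.card - 1)) * (hamX n).card := by
  have hn : U.card + 4 ≤ n := by
    have h : Disjoint U {p, q, r, s} := by
      simp [Finset.disjoint_right, *]
    have h4 : ({p, q, r, s} : Finset (Fin n)).card = 4 := by simp [*]
    have := Finset.card_le_univ (U ∪ {p, q, r, s})
    rwa [Finset.card_union_of_disjoint h, h4, Fintype.card_fin] at this
  have hm' : (1 : ℝ) < U.card := by exact_mod_cast hm
  have hn' : (U.card : ℝ) + 4 ≤ n := by exact_mod_cast hn
  have h1 := sum_edge (n := n) (by omega) hpq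
  have h2 := sum_cut_edge_quadVal hm hpU hqU hrU hsU hpq hpr hps hqr hqs hrs
  have e : ∑ x ∈ hamX n, hU U x * quadVal p q r s x * xval x p q =
      (((n : ℝ) - 1) / (2 * ((U.card : ℝ) * ((n : ℝ) - (U.card : ℝ)) + 1 - (n : ℝ)))) *
        ∑ x ∈ hamX n, (∑ u ∈ U, ∑ v ∈ Uᶜ, xval x u v - 2) *
          (xval x p q * quadVal p q r s x) := by
    rw [Finset.mul_sum]
    refine Finset.sum_congr rfl fun x _ => ?_
    rw [hU]
    ring
  have f1 : ((n : ℝ) - 2) ≠ 0 := by linarith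
  have f2 : ((n : ℝ) - U.card - 1) ≠ 0 := by linarith
  have f3 : ((U.card : ℝ) - 1) ≠ 0 := by linarith
  have f4 : (U.card : ℝ) * ((n : ℝ) - (U.card : ℝ)) + 1 - (n : ℝ) =
    (U.card - 1) * (n - U.card - 1) := by ring
  rw [e, f4, div_mul_eq_mul_div, div_mul_eq_mul_div, div_eq_div_iff (by positivity) (by positivity)]
  linear_combination (((n : ℝ) - 1) * (n - U.card - 1)) * h2
    + 2 * (U.card - 1) * (n - U.card - 2) * (n - U.card - 1) * h1

lemma sum_hU_quadVal {n : ℕ} {U : Finset (Fin n)} {p q r s : Fin n}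
    (hpU : p ∉ U) (hrU : r ∉ U) (hpq : p ≠ q) (hps : p ≠ s) (hqr : q ≠ r) (hrs : r ≠ s) :
    ∑ x ∈ hamX n, hU U x * quadVal p q r s x = 0 := by
  have h := sum_hU_quadVal_swap hpU hrU hpq hps hqr hrs (fun _ => 1)
  simp only [mul_one] at h
  linarith

lemma sum_hU_quadVal_fixed_edge {n : ℕ} {U : Finset (Fin n)} {p q r s : Fin n}
    (hpU : p ∉ U) (hrU : r ∉ U) (hpq : p ≠ q) (hps : p ≠ s) (hqr : q ≠ r) (hrs : r ≠ s)
    {a b : Fin n} (hab : s(Equiv.swap p r a, Equiv.swap p r b) = s(a, b)) :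
    ∑ x ∈ hamX n, hU U x * quadVal p q r s x * xval x a b = 0 := by
  have h := sum_hU_quadVal_swap hpU hrU hpq hps hqr hrs (fun x => xval x a b)
  simp only [xval_relabel, xval_congr _ hab] at h
  linarith

lemma sum_quadCoef_mul {n : ℕ} {p q r s : Fin n} (hpq : p ≠ q) (hps : p ≠ s)
    (hqr : q ≠ r) (hrs : r ≠ s) (x : EdgeIdx n → ℝ) :
    ∑ e : EdgeIdx n, quadCoef p q r s e * x e = quadVal p q r s x := by
  have key : ∀ {a b : Fin n}, a ≠ b →
      ∑ e : EdgeIdx n, (if (e : Sym2 (Fin n)) = s(a, b) then 1 else 0) * x e = xval x a b := by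
    intro a b hab
    rw [Finset.sum_eq_single ⟨s(a, b), by simpa using hab⟩]
    · simp [xval, hab]
    · intro e _ he
      rw [if_neg (fun h => he (Subtype.ext h)), zero_mul]
    · simp
  simp only [quadCoef, sub_mul, add_mul, Finset.sum_sub_distrib, Finset.sum_add_distrib,
    key hpq, key hqr, key hrs, key hps.symm, quadVal]

lemma sum_hU_quadVal_coord {n : ℕ} {U : Finset (Fin n)} (hm : 1 < U.card) {p q r s : Fin n}
    (hpU : p ∉ U) (hqU : q ∉ U) (hrU : r ∉ U) (hsU : s ∉ U)
    (hpq : p ≠ q) (hpr : p ≠ r) (hps : p ≠ s)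
    (hqr : q ≠ r) (hqs : q ≠ s) (hrs : r ≠ s) (e : EdgeIdx n) :
    ∑ x ∈ hamX n, hU U x * quadVal p q r s x * x e =
      2 * ((n : ℝ) - U.card - 2) / ((n - 2) * (n - U.card - 1)) * (hamX n).card *
        quadCoef p q r s e := by
  obtain ⟨e, he⟩ := e
  induction e with | _ a b => ?_
  have hab : a ≠ b := by simpa using he
  have hx : ∀ x : EdgeIdx n → ℝ, x ⟨s(a, b), he⟩ = xval x a b := fun x => by simp [xval, hab]
  rw [Finset.sum_congr rfl fun x _ => by rw [hx x]]
  have g1 := sum_hU_quadVal_edge hm hpU hqU hrU hsU hpq hpr hps hqr hqs hrs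
  have g2 := sum_hU_quadVal_edge hm hqU hrU hsU hpU hqr hqs hpq.symm hrs hpr.symm hps.symm
  have g3 := sum_hU_quadVal_edge hm hrU hsU hpU hqU hrs hpr.symm hqr.symm hps.symm hqs.symm hpq
  have g4 := sum_hU_quadVal_edge hm hsU hpU hqU hrU hps.symm hqs.symm hrs.symm hpq hpr hqr
  have z1 := sum_hU_quadVal_fixed_edge (a := a) (b := b) hpU hrU hpq hps hqr hrs
  have z2 := sum_hU_quadVal_fixed_edge (a := a) (b := b) hqU hsU hqr hpq.symm hrs hps.symm
  simp only [quadVal_rotate r s p q, quadVal_rotate q r s p, quadVal_rotate p q r s, neg_neg,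
    mul_neg, neg_mul, Finset.sum_neg_distrib, neg_eq_zero] at g1 g2 g3 g4 z1 z2
  by_cases h1 : s(a, b) = s(p, q)
  · have hc : quadCoef p q r s ⟨s(a, b), he⟩ = 1 := by simp [quadCoef, *, Ne.symm]
    simp only [xval_congr _ h1, hc, mul_one, g1]
  by_cases h2 : s(a, b) = s(q, r)
  · have hc : quadCoef p q r s ⟨s(a, b), he⟩ = -1 := by simp [quadCoef, *, Ne.symm]
    simp only [xval_congr _ h2, hc, mul_neg, mul_one, ← g2, neg_neg]
  by_cases h3 : s(a, b) = s(r, s)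
  · have hc : quadCoef p q r s ⟨s(a, b), he⟩ = 1 := by simp [quadCoef, *, Ne.symm]
    simp only [xval_congr _ h3, hc, mul_one, g3]
  by_cases h4 : s(a, b) = s(s, p)
  · have hc : quadCoef p q r s ⟨s(a, b), he⟩ = -1 := by simp [quadCoef, *, Ne.symm]
    simp only [xval_congr _ h4, hc, mul_neg, mul_one, ← g4, neg_neg]
  have hc : quadCoef p q r s ⟨s(a, b), he⟩ = 0 := by
    simp only [quadCoef, h1, h2, h3, h4, if_false]
    norm_num
  rw [hc, mul_zero]
  by_cases h : s(Equiv.swap p r a, Equiv.swap p r b) = s(a, b)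
  · exact z1 h
  · refine z2 ?_
    simp only [Sym2.eq_iff, Equiv.swap_apply_def] at *
    grind

/-- **eigenvector of `A_U`, quadrilateral outside `U`.**
Let `n ≥ 6`, `U ⊂ {1, …, n}`, `|U| = m`, `3 ≤ m ≤ n/2`, `n - m ≥ 4`, and let
`p, q, r, s ∉ U` be distinct.  The degree-1 polynomial
`u(x) = x_{pq} - x_{qr} + x_{rs} - x_{sp}` satisfies, for every degree-≤1
polynomial `w(x) = w₀ + Σ_e w_e x_e`,
`(1/|X|) Σ_{x∈X} h_U(x) u(x) w(x) = (2(n-m-2)/((n-2)(n-m-1))) ⟨u, w⟩`;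
i.e. `u` is an eigenvector of the matrix of `q_{h_U}` with eigenvalue
`2(n-m-2)/((n-2)(n-m-1))`. -/
theorem eigenvector_of_subtour_form_outside_U
    (n m : ℕ) (hn : 6 ≤ n) (U : Finset (Fin n)) (hUcard : U.card = m)
    (hm3 : 3 ≤ m) (hmn : 2 * m ≤ n) (hnm4 : 4 ≤ n - m)
    (p q r s : Fin n) (hpU : p ∉ U) (hqU : q ∉ U) (hrU : r ∉ U) (hsU : s ∉ U)
    (hpq : p ≠ q) (hpr : p ≠ r) (hps : p ≠ s)
    (hqr : q ≠ r) (hqs : q ≠ s) (hrs : r ≠ s)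
    (w0 : ℝ) (w : EdgeIdx n → ℝ) :
    ((hamX n).card : ℝ)⁻¹ * ∑ x ∈ hamX n,
        hU U x * (∑ e : EdgeIdx n, quadCoef p q r s e * x e) *
          (w0 + ∑ e : EdgeIdx n, w e * x e)
      = (2 * ((n : ℝ) - (m : ℝ) - 2) / (((n : ℝ) - 2) * ((n : ℝ) - (m : ℝ) - 1))) *
          ∑ e : EdgeIdx n, quadCoef p q r s e * w e := by
  have hU1 : 1 < U.card := by omega
  have hcard : ((hamX n).card : ℝ) ≠ 0 := by
    rw [Nat.cast_ne_zero, Finset.card_ne_zero]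
    exact Finset.univ_nonempty.image _
  simp only [sum_quadCoef_mul hpq hps hqr hrs, mul_add, Finset.sum_add_distrib,
    ← Finset.sum_mul, sum_hU_quadVal hpU hrU hpq hps hqr hrs, zero_mul, zero_add]
  rw [← sum_quadCoef_mul hpq hps hqr hrs w]
  simp only [Finset.mul_sum]
  rw [Finset.sum_comm]
  refine Finset.sum_congr rfl fun e _ => ?_
  have h := sum_hU_quadVal_coord hU1 hpU hqU hrU hsU hpq hpr hps hqr hqs hrs e
  have h' : ∑ x ∈ hamX n, ((hamX n).card : ℝ)⁻¹ * (hU U x * quadVal p q r s x * (w e * x e)) =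
      ((hamX n).card : ℝ)⁻¹ * (w e * ∑ x ∈ hamX n, hU U x * quadVal p q r s x * x e) := by
    rw [Finset.mul_sum, Finset.mul_sum]
    exact Finset.sum_congr rfl fun x _ => by ring
  rw [h', h, hUcard, inv_mul_eq_iff_eq_mul₀ hcard]
  ring
end
end

section
/- Let n ≥ 9 and let U ⊂ {1, ..., n} with |U| = m, 3 ≤ m ≤ n/2. Set a = √n and f = a·h_U + (1-a)·𝟙. Then there exists a subspace W of dimension at least n+1 of the space of polynomials of degree at most 1 on ℝ^{n(n-1)/2} such that (1/|X|) Σ_{x∈X} f(x) p(x)² ≤ 0 for every p ∈ W. In particular, the quadratic form q_f has a nonpositive eigenvalue beyond the n zero eigenvalues coming from the degree constraints, so that the scaling of the subtour elimination constraint h_U by √n (with respect to the center 𝟙) lies outside P_1 or on its boundary. -/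
open Finset
noncomputable section
open scoped Classical

/-- The number of cyclic descents from `1` to `0` of a `0`/`1`-valued word `w`. -/
def runs {N : ℕ} (w : Fin (N + 1) → ℝ) : ℝ := ∑ i, w i * (1 - w (i + 1))

theorem runs_comp_add_right {N : ℕ} (w : Fin (N + 1) → ℝ) (t : Fin (N + 1)) :
    runs (fun i => w (i + t)) = runs w := by
  unfold runs
  rw [← Equiv.sum_comp (Equiv.addRight t) (fun i => w i * (1 - w (i + 1)))]
  refine Finset.sum_congr rfl fun i _ => ?_
  simp only [Equiv.coe_addRight, add_right_comm]

/-- Reversal of the initial segment `0, …, j` of `Fin (N + 1)`. -/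
def segRev {N : ℕ} (j : Fin (N + 1)) : Equiv.Perm (Fin (N + 1)) :=
  Function.Involutive.toPerm
    (fun x => if x ≤ j then ⟨j - x, by omega⟩ else x) (by
      intro x
      by_cases h : x ≤ j
      · have h' : (x : ℕ) ≤ j := h
        have h'' : (⟨j - x, by omega⟩ : Fin (N + 1)) ≤ j := Nat.sub_le _ _
        simp only [if_pos h, if_pos h'']
        exact Fin.ext (Nat.sub_sub_self h')
      · simp [h])

theorem segRev_apply {N : ℕ} (j x : Fin (N + 1)) :
    segRev j x = if x ≤ j then ⟨j - x, by omega⟩ else x := rfl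

theorem segRev_zero {N : ℕ} (j : Fin (N + 1)) : segRev j 0 = j := by
  rw [segRev_apply, if_pos (Fin.zero_le j)]; ext; simp

theorem segRev_last {N : ℕ} {j : Fin (N + 1)} (hj : j ≠ Fin.last N) :
    segRev j (Fin.last N) = Fin.last N := by
  rw [segRev_apply, if_neg (not_le.2 (Fin.lt_last_iff_ne_last.2 hj))]

theorem sum_range_reverse_initial (w : ℕ → ℝ) (j r : ℕ) (w' : ℕ → ℝ)
    (hw' : ∀ x, w' x = if x ≤ j then w (j - x) else w x) :
    ∑ x ∈ range (j + 1 + r), w' x * w' (x + 1) =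
      ∑ x ∈ range (j + 1 + r), w x * w (x + 1) - w j * w (j + 1) + w 0 * w (j + 1) := by
  simp only [sum_range_add _ (j + 1) r, sum_range_succ _ j]
  have htail : ∑ x ∈ range r, w' (j + 1 + x) * w' (j + 1 + x + 1) =
      ∑ x ∈ range r, w (j + 1 + x) * w (j + 1 + x + 1) := by
    refine sum_congr rfl fun x _ => ?_
    rw [hw', hw', if_neg (by omega), if_neg (by omega)]
  have hhead : ∑ x ∈ range j, w' x * w' (x + 1) = ∑ x ∈ range j, w x * w (x + 1) := by
    rw [← sum_range_reflect (fun x => w x * w (x + 1)) j]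
    refine sum_congr rfl fun x hx => ?_
    have hx' := mem_range.1 hx
    rw [hw', hw', if_pos (by omega), if_pos (by omega), mul_comm]
    congr 2 <;> omega
  rw [htail, hhead, hw' j, hw' (j + 1), if_pos le_rfl, if_neg (by omega), Nat.sub_self]
  ring

theorem runs_eq_sum_sub {N : ℕ} (w : Fin (N + 1) → ℝ) :
    runs w = ∑ i, w i - ∑ i, w i * w (i + 1) := by
  simp [runs, mul_sub, sum_sub_distrib]

theorem sum_mul_succ_eq_sum_range {N : ℕ} (w : Fin (N + 1) → ℝ) (v : ℕ → ℝ)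
    (hv : ∀ x : Fin (N + 1), v x = w x) :
    ∑ i, w i * w (i + 1) = ∑ x ∈ range N, v x * v (x + 1) + w (Fin.last N) * w 0 := by
  rw [Fin.sum_univ_castSucc, Fin.last_add_one, ← Fin.sum_univ_eq_sum_range
    (fun x => v x * v (x + 1))]
  congr 1
  refine sum_congr rfl fun i _ => ?_
  rw [Fin.coeSucc_eq_succ, ← hv, ← hv, Fin.val_castSucc, Fin.val_succ]

theorem runs_comp_segRev {N : ℕ} (w : Fin (N + 1) → ℝ) (j : Fin (N + 1))
    (hj : j ≠ Fin.last N) :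
    runs (fun i => w (segRev j i)) = runs w + w (Fin.last N) * w 0 + w j * w (j + 1)
      - w (Fin.last N) * w j - w 0 * w (j + 1) := by
  have hjN : (j : ℕ) < N := Fin.val_lt_last hj
  have hj1 : ((j + 1 : Fin (N + 1)) : ℕ) = j + 1 :=
    Fin.val_add_one_of_lt (Fin.lt_last_iff_ne_last.2 hj)
  let v : ℕ → ℝ := fun x => if h : x < N + 1 then w ⟨x, h⟩ else 0
  have hv : ∀ x : Fin (N + 1), v x = w x := fun x => dif_pos x.isLt
  let v' : ℕ → ℝ := fun x => if x ≤ j then v (j - x) else v x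
  have hv' : ∀ x : Fin (N + 1), v' x = w (segRev j x) := fun x => by
    rw [segRev_apply]
    by_cases h : x ≤ j
    · rw [if_pos h, ← hv]
      exact if_pos (Fin.le_def.1 h)
    · rw [if_neg h, ← hv]
      exact if_neg fun h' => h (Fin.le_def.2 h')
  have hlast := segRev_last hj
  obtain ⟨r, hr⟩ : ∃ r, N = j + 1 + r := ⟨N - (j + 1), by omega⟩
  have hsum := sum_range_reverse_initial v j r v' fun _ => rfl
  rw [← hr, hv j, ← hj1, hv (j + 1)] at hsum
  have h0 : v 0 = w 0 := hv 0
  rw [runs_eq_sum_sub, runs_eq_sum_sub, Equiv.sum_comp (segRev j) w,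
    sum_mul_succ_eq_sum_range _ v' hv', sum_mul_succ_eq_sum_range w v hv, hsum,
    hlast, segRev_zero, h0]
  ring

theorem sum_perm_two_opt_last {N : ℕ} (χ : Fin (N + 1) → ℝ) (hχ : ∀ i, χ i = 0 ∨ χ i = 1)
    (g : ℝ → ℝ) (j : Fin (N + 1)) (hj : j ≠ Fin.last N) :
    ∑ σ : Equiv.Perm (Fin (N + 1)), χ (σ (Fin.last N)) * χ (σ 0) * (1 - χ (σ j)) *
        (1 - χ (σ (j + 1))) * g (runs fun i => χ (σ i)) =
      ∑ σ : Equiv.Perm (Fin (N + 1)), χ (σ (Fin.last N)) * (1 - χ (σ 0)) * χ (σ j) *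
        (1 - χ (σ (j + 1))) * g (runs (fun i => χ (σ i)) - 1) := by
  have hj1 : ((j + 1 : Fin (N + 1)) : ℕ) = j + 1 :=
    Fin.val_add_one_of_lt (Fin.lt_last_iff_ne_last.2 hj)
  have hlast := segRev_last hj
  have hself : segRev j j = 0 := by
    rw [segRev_apply, if_pos le_rfl]; ext; simp
  have hsucc : segRev j (j + 1) = j + 1 := by
    rw [segRev_apply, if_neg]
    rw [Fin.le_def, hj1]; omega
  rw [← Equiv.sum_comp (Equiv.mulRight (segRev j))]
  refine sum_congr rfl fun σ _ => ?_
  simp only [Equiv.coe_mulRight, Equiv.Perm.coe_mul, Function.comp_apply, hlast, segRev_zero, hself,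
    hsucc]
  rw [runs_comp_segRev (fun i => χ (σ i)) j hj]
  rcases hχ (σ (Fin.last N)) with h1 | h1 <;> rcases hχ (σ 0) with h2 | h2 <;>
    rcases hχ (σ j) with h3 | h3 <;> rcases hχ (σ (j + 1)) with h4 | h4 <;>
    simp [h1, h2, h3, h4]

theorem sum_perm_two_opt {N : ℕ} (χ : Fin (N + 1) → ℝ) (hχ : ∀ i, χ i = 0 ∨ χ i = 1)
    (g : ℝ → ℝ) (i j : Fin (N + 1)) (hij : i ≠ j) :
    ∑ σ : Equiv.Perm (Fin (N + 1)), χ (σ i) * χ (σ (i + 1)) * (1 - χ (σ j)) *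
        (1 - χ (σ (j + 1))) * g (runs fun i => χ (σ i)) =
      ∑ σ : Equiv.Perm (Fin (N + 1)), χ (σ i) * (1 - χ (σ (i + 1))) * χ (σ j) *
        (1 - χ (σ (j + 1))) * g (runs (fun i => χ (σ i)) - 1) := by
  obtain ⟨t, rfl⟩ : ∃ t, i = Fin.last N + t := ⟨i - Fin.last N, by abel⟩
  obtain ⟨l, rfl⟩ : ∃ l, j = l + t := ⟨j - t, by abel⟩
  have hl : l ≠ Fin.last N := fun h => hij (by rw [h])
  have h := sum_perm_two_opt_last χ hχ g l hl
  rw [← Equiv.sum_comp (Equiv.mulRight (Equiv.addRight t))] at h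
  conv_rhs at h => rw [← Equiv.sum_comp (Equiv.mulRight (Equiv.addRight t))]
  have hr : ∀ σ : Equiv.Perm (Fin (N + 1)),
      runs (fun i => χ (σ (i + t))) = runs fun i => χ (σ i) :=
    fun σ => runs_comp_add_right (fun i => χ (σ i)) t
  simp only [Equiv.coe_mulRight, Equiv.Perm.coe_mul, Function.comp_apply, Equiv.coe_addRight,
    hr] at h
  rw [add_right_comm _ t 1, add_right_comm _ t 1, Fin.last_add_one]
  exact h

/-- Reversing the arc between a `11`-edge and a `00`-edge of a cyclic word creates one more
descent; this relates the moments of the number of descents of a random arrangement. -/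
theorem sum_perm_runs {N : ℕ} (χ : Fin (N + 1) → ℝ) (hχ : ∀ i, χ i = 0 ∨ χ i = 1)
    (g : ℝ → ℝ) (m : ℝ) (hm : ∑ i, χ i = m) :
    ∑ σ : Equiv.Perm (Fin (N + 1)), (m - runs fun i => χ (σ i)) *
        ((N : ℝ) + 1 - m - runs fun i => χ (σ i)) * g (runs fun i => χ (σ i)) =
      ∑ σ : Equiv.Perm (Fin (N + 1)), (runs fun i => χ (σ i)) * ((runs fun i => χ (σ i)) - 1) *
        g (runs (fun i => χ (σ i)) - 1) := by
  have hsum : ∀ σ : Equiv.Perm (Fin (N + 1)), ∑ i, χ (σ i) = m := fun σ => by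
    rw [Equiv.sum_comp σ χ, hm]
  have hsum' : ∀ σ : Equiv.Perm (Fin (N + 1)), ∑ i, χ (σ (i + 1)) = m := fun σ => by
    rw [← hsum σ]; exact Equiv.sum_comp (Equiv.addRight 1) fun i => χ (σ i)
  have hleft : ∀ σ : Equiv.Perm (Fin (N + 1)), (m - runs fun i => χ (σ i)) *
        ((N : ℝ) + 1 - m - runs fun i => χ (σ i)) * g (runs fun i => χ (σ i)) =
      ∑ i, ∑ j, χ (σ i) * χ (σ (i + 1)) * (1 - χ (σ j)) *
        (1 - χ (σ (j + 1))) * g (runs fun i => χ (σ i)) := fun σ => by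
    have h1 : m - (runs fun i => χ (σ i)) = ∑ i, χ (σ i) * χ (σ (i + 1)) := by
      rw [runs_eq_sum_sub, hsum]; ring
    have h2 : (N : ℝ) + 1 - m - (runs fun i => χ (σ i)) =
        ∑ j, (1 - χ (σ j)) * (1 - χ (σ (j + 1))) := by
      simp only [sub_mul, mul_sub, sum_sub_distrib, one_mul, mul_one, hsum, hsum', ← h1]
      simp
    rw [h1, h2, sum_mul_sum, sum_mul]
    refine sum_congr rfl fun i _ => ?_
    rw [sum_mul]
    refine sum_congr rfl fun j _ => ?_
    ring
  have hright : ∀ σ : Equiv.Perm (Fin (N + 1)),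
      (runs fun i => χ (σ i)) * ((runs fun i => χ (σ i)) - 1) * g (runs (fun i => χ (σ i)) - 1) =
      ∑ i, ∑ j, (if i = j then 0 else χ (σ i) * (1 - χ (σ (i + 1))) * χ (σ j) *
        (1 - χ (σ (j + 1))) * g (runs (fun i => χ (σ i)) - 1)) := fun σ => by
    set G := g (runs (fun i => χ (σ i)) - 1)
    have h : ∀ i j, (if i = j then 0 else χ (σ i) * (1 - χ (σ (i + 1))) * χ (σ j) *
        (1 - χ (σ (j + 1))) * G) = χ (σ i) * (1 - χ (σ (i + 1))) * (χ (σ j) *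
        (1 - χ (σ (j + 1)))) * G - if i = j then χ (σ i) * (1 - χ (σ (i + 1))) * G else 0 := by
      intro i j
      split_ifs with hij
      · subst hij
        rcases hχ (σ i) with h1 | h1 <;> rcases hχ (σ (i + 1)) with h2 | h2 <;> simp [h1, h2]
      · ring
    simp only [h, sum_sub_distrib, sum_ite_eq, mem_univ, if_true, ← sum_mul, ← mul_sum]
    simp only [runs]
    ring
  simp only [hleft, hright]
  rw [sum_comm, sum_comm (s := univ (α := Equiv.Perm (Fin (N + 1))))]
  refine sum_congr rfl fun i _ => ?_
  rw [sum_comm, sum_comm (s := univ (α := Equiv.Perm (Fin (N + 1))))]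
  refine sum_congr rfl fun j _ => ?_
  by_cases hij : i = j
  · subst hij
    simp only [if_true, sum_const_zero]
    refine sum_eq_zero fun σ _ => ?_
    rcases hχ (σ i) with h1 | h1 <;> simp [h1]
  · simp only [if_neg hij]
    exact sum_perm_two_opt χ hχ g i j hij

theorem div_add_le_of_card_bounds (n m a D v : ℝ) (hn9 : 9 ≤ n) (hm3 : 3 ≤ m)
    (hmn : 2 * m ≤ n) (ha : 0 ≤ a) (han : a ^ 2 = n)
    (hD : D = (m * (n - m) + 1 - n) / (n - 1)) (hDpos : 0 < D)
    (hv : v = m * (n - m) * D / ((n - 1) * (n - 2))) :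
    a / ((n - 1) * (n - 3)) + D ≤ n * v / D := by
  have hn1 : 0 < n - 1 := by linarith
  have hn2 : 0 < n - 2 := by linarith
  have hn3 : 0 < n - 3 := by linarith
  have ha3 : 3 ≤ a := by nlinarith
  have hale : a ≤ n - 3 := by nlinarith
  have h1 : a / ((n - 1) * (n - 3)) ≤ 1 / (n - 1) := by
    rw [div_le_div_iff₀ (mul_pos hn1 hn3) hn1, one_mul, mul_comm]
    exact mul_le_mul_of_nonneg_left hale hn1.le
  have h2 : 1 / (n - 1) + D ≤ n * v / D := by
    have h3 : n * v / D = n * (m * (n - m)) / (n - 2) / (n - 1) := by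
      rw [hv]; field_simp
    rw [h3, hD, ← add_div]
    refine div_le_div_of_nonneg_right ?_ hn1.le
    rw [le_div_iff₀ hn2]
    have h4 : 0 ≤ m * (n - m) := mul_nonneg (by linarith) (by linarith)
    nlinarith
  linarith

theorem sum_perm_weighted_sq_runs_nonpos {N : ℕ} (χ : Fin (N + 1) → ℝ)
    (hχ : ∀ i, χ i = 0 ∨ χ i = 1) (n m a : ℝ) (hn : n = N + 1) (hn9 : 9 ≤ n)
    (hm : ∑ i, χ i = m) (hm3 : 3 ≤ m) (hmn : 2 * m ≤ n) (ha : 0 ≤ a) (han : a ^ 2 = n)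
    (D v : ℝ) (hD : D = (m * (n - m) + 1 - n) / (n - 1))
    (hv : v = m * (n - m) * D / ((n - 1) * (n - 2))) :
    ∑ σ : Equiv.Perm (Fin (N + 1)),
      (a * ((runs (fun i => χ (σ i)) - 1) / D) + (1 - a)) *
        (a * v / D + 1 + D - runs fun i => χ (σ i)) ^ 2 ≤ 0 := by
  have e0 := sum_perm_runs χ hχ (fun _ => 1) m hm
  have e1 := sum_perm_runs χ hχ (fun r => r) m hm
  have e2 := sum_perm_runs χ hχ (fun r => r ^ 2) m hm
  rw [← hn] at e0 e1 e2
  set R : Equiv.Perm (Fin (N + 1)) → ℝ := fun σ => runs fun i => χ (σ i) with hR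
  set M0 : ℝ := ∑ _σ : Equiv.Perm (Fin (N + 1)), (1 : ℝ) with hM0
  have hM0pos : 0 ≤ M0 := sum_nonneg fun _ _ => zero_le_one
  set M1 : ℝ := ∑ σ, R σ with hM1
  set M2 : ℝ := ∑ σ, R σ ^ 2 with hM2
  set M3 : ℝ := ∑ σ, R σ ^ 3 with hM3
  have f0 : m * (n - m) * M0 - (n - 1) * M1 = 0 := by
    rw [← sub_eq_zero, ← sum_sub_distrib] at e0
    rw [hM0, hM1, mul_sum, mul_sum, ← sum_sub_distrib, ← e0]
    refine sum_congr rfl fun σ _ => ?_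
    simp only [hR]; ring
  have f1 : (m * (n - m) - 1) * M1 - (n - 2) * M2 = 0 := by
    rw [← sub_eq_zero, ← sum_sub_distrib] at e1
    rw [hM1, hM2, mul_sum, mul_sum, ← sum_sub_distrib, ← e1]
    refine sum_congr rfl fun σ _ => ?_
    simp only [hR]; ring
  have f2 : (m * (n - m) - 3) * M2 + M1 - (n - 3) * M3 = 0 := by
    rw [← sub_eq_zero, ← sum_sub_distrib] at e2
    rw [hM1, hM2, hM3, mul_sum, mul_sum, ← sum_add_distrib, ← sum_sub_distrib, ← e2]
    refine sum_congr rfl fun σ _ => ?_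
    simp only [hR]; ring
  have hD' : D = (m - 1) * (n - m - 1) / (n - 1) := by rw [hD]; ring
  have hDpos : 0 < D := by
    rw [hD']; apply div_pos (mul_pos _ _) <;> linarith
  have hn1 : n - 1 ≠ 0 := by linarith
  have hn2 : n - 2 ≠ 0 := by linarith
  have hn3 : n - 3 ≠ 0 := by linarith
  have hvpos : 0 < v := by
    rw [hv]
    have : 0 < n - m := by linarith
    have : 0 < n - 1 := by linarith
    have : 0 < n - 2 := by linarith
    have : 0 < m := by linarith
    positivity
  have c1 : M1 = (1 + D) * M0 := by
    rw [hD]; field_simp; linear_combination -f0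
  have c2 : M2 = (v + (1 + D) ^ 2) * M0 := by
    have : M2 = (m * (n - m) - 1) * M1 / (n - 2) := by
      field_simp; linear_combination -f1
    rw [this, c1, hv, hD]; field_simp; ring
  -- the third central moment
  set κ : ℝ := v * ((1 - (n - 2 * m) ^ 2) / ((n - 1) * (n - 3))) with hκ
  have c3 : M3 = (κ + 3 * v * (1 + D) + (1 + D) ^ 3) * M0 := by
    have : M3 = ((m * (n - m) - 3) * M2 + M1) / (n - 3) := by
      field_simp; linear_combination -f2
    rw [this, c2, c1, hκ, hv, hD]; field_simp; ring
  have hexp : ∑ σ, (a * ((R σ - 1) / D) + (1 - a)) * (a * v / D + 1 + D - R σ) ^ 2 =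
      (a * κ / D + v - (a * v / D) ^ 2) * M0 := by
    set b : ℝ := a * v / D + 1 + D with hb
    have h : ∀ σ, (a * ((R σ - 1) / D) + (1 - a)) * (b - R σ) ^ 2 =
        (1 - a - a / D) * b ^ 2 * 1 + (a / D * b ^ 2 - 2 * b * (1 - a - a / D)) * R σ
          + ((1 - a - a / D) - 2 * b * (a / D)) * R σ ^ 2 + a / D * R σ ^ 3 := fun σ => by ring
    simp only [h, sum_add_distrib, ← mul_sum]
    rw [← hM0, ← hM1, ← hM2, ← hM3, c1, c2, c3, hb]
    field_simp
    ring
  rw [hexp]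
  refine mul_nonpos_of_nonpos_of_nonneg ?_ hM0pos
  have hκle : κ ≤ v / ((n - 1) * (n - 3)) := by
    rw [hκ, div_eq_mul_one_div v]
    have : 0 < n - 1 := by linarith
    have : 0 < n - 3 := by linarith
    gcongr
    nlinarith [sq_nonneg (n - 2 * m)]
  have key := div_add_le_of_card_bounds n m a D v hn9 hm3 hmn ha han hD hDpos hv
  have : a * κ / D + v - (a * v / D) ^ 2 =
      (v / D) * (a * (κ / v) + D - n * v / D) := by
    rw [← han]; field_simp
  rw [this]
  refine mul_nonpos_of_nonneg_of_nonpos (by positivity) ?_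
  have : κ / v ≤ 1 / ((n - 1) * (n - 3)) := by
    rwa [div_le_iff₀ hvpos, one_div_mul_eq_div]
  have := mul_le_mul_of_nonneg_left this ha
  rw [mul_one_div] at this
  linarith

theorem exists_edge_mul_iff {n : ℕ} (τ σ : Equiv.Perm (Fin n)) (e : Sym2 (Fin n)) :
    (∃ i, Sym2.map τ e = s((τ * σ) i, (τ * σ) (finRotate n i))) ↔
      ∃ i, e = s(σ i, σ (finRotate n i)) := by
  refine exists_congr fun i => ?_
  rw [← (Sym2.map.injective τ.injective).eq_iff (a := e)]
  rfl

theorem cycleVec_mul_left_congr {n : ℕ} (τ σ σ' : Equiv.Perm (Fin n))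
    (h : cycleVec n σ = cycleVec n σ') : cycleVec n (τ * σ) = cycleVec n (τ * σ') := by
  have key : ∀ (ρ : Equiv.Perm (Fin n)) (e : EdgeIdx n) (he : ¬ (Sym2.map τ.symm e.1).IsDiag),
      cycleVec n (τ * ρ) e = cycleVec n ρ ⟨Sym2.map τ.symm e.1, he⟩ := by
    intro ρ e he
    unfold cycleVec
    have hmap : Sym2.map τ (Sym2.map τ.symm e.1) = e.1 := by
      rw [Sym2.map_map, Equiv.self_comp_symm, Sym2.map_id, id]
    have := exists_edge_mul_iff τ ρ (Sym2.map τ.symm e.1)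
    rw [hmap] at this
    simp only [this]
  funext e
  have he : ¬ (Sym2.map τ.symm e.1).IsDiag := by
    rw [Sym2.isDiag_map τ.symm.injective]
    exact e.2
  rw [key σ e he, key σ' e he, h]

theorem cycleVec_mul_left_inj {n : ℕ} (τ σ σ' : Equiv.Perm (Fin n)) :
    cycleVec n (τ * σ) = cycleVec n (τ * σ') ↔ cycleVec n σ = cycleVec n σ' := by
  refine ⟨fun h => ?_, cycleVec_mul_left_congr τ σ σ'⟩
  simpa using cycleVec_mul_left_congr τ⁻¹ _ _ h

/-- Every Hamiltonian cycle is traversed by the same positive number of permutations. -/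
theorem exists_sum_perm_eq_mul_sum_hamX (n : ℕ) :
    ∃ c : ℝ, 0 < c ∧ ∀ G : (EdgeIdx n → ℝ) → ℝ,
      ∑ σ, G (cycleVec n σ) = c * ∑ x ∈ hamX n, G x := by
  refine ⟨#{σ | cycleVec n σ = cycleVec n 1}, ?_, fun G => ?_⟩
  · exact_mod_cast card_pos.2 ⟨1, by simp⟩
  rw [← sum_fiberwise_of_maps_to (t := hamX n) (g := cycleVec n)
    (fun σ _ => mem_image_of_mem _ (mem_univ σ)), mul_sum]
  refine sum_congr rfl fun x hx => ?_
  obtain ⟨τ, -, rfl⟩ := mem_image.1 hx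
  rw [sum_congr rfl fun σ hσ => by rw [(mem_filter.1 hσ).2], sum_const, nsmul_eq_mul]
  congr 2
  refine (card_equiv (Equiv.mulLeft τ) fun σ => ?_).symm
  have := cycleVec_mul_left_inj τ σ 1
  simp only [mul_one] at this
  simp [this]

theorem Fin.add_one_add_one_ne_self {N : ℕ} (hN : 2 ≤ N) (i : Fin (N + 1)) : i + 1 + 1 ≠ i := by
  intro h
  have h2 : (1 + 1 : Fin (N + 1)) = 0 := by
    rwa [add_assoc, add_eq_left] at h
  have := congrArg Fin.val h2
  rw [Fin.val_add, Fin.val_one', Nat.mod_eq_of_lt (a := 1) (by omega),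
    Nat.mod_eq_of_lt (by omega)] at this
  simp at this

theorem Fin.add_one_ne_self {N : ℕ} (hN : 2 ≤ N) (i : Fin (N + 1)) : i + 1 ≠ i := by
  intro h
  exact Fin.add_one_add_one_ne_self hN i (by rw [h, h])

theorem cycleEdge_injective {N : ℕ} (hN : 2 ≤ N) (σ : Equiv.Perm (Fin (N + 1))) :
    Function.Injective fun i => s(σ i, σ (i + 1)) := by
  intro i j h
  rcases Sym2.eq_iff.1 h with ⟨h1, -⟩ | ⟨h1, h2⟩
  · exact σ.injective h1
  · exfalso
    have h1 := σ.injective h1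
    have h2 := σ.injective h2
    rw [h1] at h2
    exact Fin.add_one_add_one_ne_self hN j h2

theorem ite_exists_cycleEdge {N : ℕ} (hN : 2 ≤ N) (σ : Equiv.Perm (Fin (N + 1)))
    (e : Sym2 (Fin (N + 1))) :
    (if ∃ i, e = s(σ i, σ (finRotate (N + 1) i)) then (1 : ℝ) else 0) =
      ∑ i, if e = s(σ i, σ (i + 1)) then 1 else 0 := by
  simp only [finRotate_apply]
  split_ifs with h
  · obtain ⟨i, rfl⟩ := h
    have : ∀ j, s(σ i, σ (i + 1)) = s(σ j, σ (j + 1)) ↔ i = j :=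
      fun j => (cycleEdge_injective hN σ).eq_iff (a := i) (b := j)
    simp [this]
  · push Not at h
    simp [h]

theorem sum_mul_cycleVec {N : ℕ} (hN : 2 ≤ N) (σ : Equiv.Perm (Fin (N + 1)))
    (c : Sym2 (Fin (N + 1)) → ℝ) :
    ∑ e : EdgeIdx (N + 1), c e * cycleVec (N + 1) σ e = ∑ i, c s(σ i, σ (i + 1)) := by
  simp only [cycleVec, ite_exists_cycleEdge hN, mul_sum]
  rw [sum_comm]
  refine sum_congr rfl fun i _ => ?_
  have hi : ¬ (s(σ i, σ (i + 1))).IsDiag := by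
    rw [Sym2.mk_isDiag_iff]
    exact fun h => Fin.add_one_ne_self hN i (σ.injective h.symm)
  rw [sum_eq_single_of_mem (⟨s(σ i, σ (i + 1)), hi⟩ : EdgeIdx (N + 1)) (mem_univ _)]
  · simp
  · intro e _ he
    rw [if_neg fun h => he (Subtype.ext h), mul_zero]

/-- The indicator of a finite set, as a real-valued function. -/
def chi {n : ℕ} (U : Finset (Fin n)) (i : Fin n) : ℝ := if i ∈ U then 1 else 0

/-- The indicator of the edges leaving `U`. -/
def cutWeight {n : ℕ} (U : Finset (Fin n)) : Sym2 (Fin n) → ℝ :=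
  Sym2.lift ⟨fun a b => chi U a * (1 - chi U b) + chi U b * (1 - chi U a), fun a b => by ring⟩

/-- The edge weight obtained by adding the weights of the two end points. -/
def vertexWeight {n : ℕ} (d : Fin n → ℝ) : Sym2 (Fin n) → ℝ :=
  Sym2.lift ⟨fun a b => d a + d b, fun _ _ => add_comm _ _⟩

theorem sum_succ_mul_one_sub_eq_runs {N : ℕ} (w : Fin (N + 1) → ℝ) :
    ∑ i, w (i + 1) * (1 - w i) = runs w := by
  rw [runs_eq_sum_sub, ← Equiv.sum_comp (Equiv.addRight 1) w, ← sum_sub_distrib]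
  refine sum_congr rfl fun i _ => ?_
  simp only [Equiv.coe_addRight]
  ring

theorem sum_cutWeight {N : ℕ} (U : Finset (Fin (N + 1))) (σ : Equiv.Perm (Fin (N + 1))) :
    ∑ i, cutWeight U s(σ i, σ (i + 1)) = 2 * runs fun i => chi U (σ i) := by
  simp only [cutWeight, Sym2.lift_mk, sum_add_distrib]
  rw [sum_succ_mul_one_sub_eq_runs fun i => chi U (σ i), two_mul]
  rfl

theorem sum_vertexWeight {N : ℕ} (d : Fin (N + 1) → ℝ) (σ : Equiv.Perm (Fin (N + 1))) :
    ∑ i, vertexWeight d s(σ i, σ (i + 1)) = 2 * ∑ i, d i := by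
  simp only [vertexWeight, Sym2.lift_mk, sum_add_distrib]
  rw [Equiv.sum_comp σ d, two_mul, ← Equiv.sum_comp σ d]
  congr 1
  exact Equiv.sum_comp (Equiv.addRight 1) fun i => d (σ i)

theorem xval_cycleVec {N : ℕ} (hN : 2 ≤ N) (σ : Equiv.Perm (Fin (N + 1)))
    {u v : Fin (N + 1)} (huv : u ≠ v) :
    xval (cycleVec (N + 1) σ) u v = ∑ i, if s(u, v) = s(σ i, σ (i + 1)) then 1 else 0 := by
  rw [xval, dif_neg huv, cycleVec]
  exact ite_exists_cycleEdge hN σ s(u, v)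

theorem sum_ite_eq_cutWeight {n : ℕ} (U : Finset (Fin n)) {a b : Fin n} (hab : a ≠ b) :
    (∑ u ∈ U, ∑ v ∈ Uᶜ, if s(u, v) = s(a, b) then (1 : ℝ) else 0) = cutWeight U s(a, b) := by
  have h : ∀ u v : Fin n, (if s(u, v) = s(a, b) then (1 : ℝ) else 0) =
      (if u = a then 1 else 0) * (if v = b then 1 else 0) +
      (if u = b then 1 else 0) * (if v = a then 1 else 0) := by
    intro u v
    simp only [Sym2.eq_iff]
    by_cases h1 : u = a
    · subst h1; simp [hab]
    · by_cases h2 : u = b <;> simp [h1, h2, hab.symm]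
  simp only [h, sum_add_distrib, ← mul_sum, ← sum_mul, sum_ite_eq', mem_compl]
  have h' : ∀ x : Fin n, (if x ∉ U then (1 : ℝ) else 0) = 1 - chi U x := by
    intro x
    unfold chi
    split_ifs <;> simp_all
  simp only [h', cutWeight, Sym2.lift_mk, chi]

theorem sum_xval_cycleVec {N : ℕ} (hN : 2 ≤ N) (U : Finset (Fin (N + 1)))
    (σ : Equiv.Perm (Fin (N + 1))) :
    ∑ u ∈ U, ∑ v ∈ Uᶜ, xval (cycleVec (N + 1) σ) u v = 2 * runs fun i => chi U (σ i) := by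
  have h : ∀ u ∈ U, ∀ v ∈ Uᶜ, xval (cycleVec (N + 1) σ) u v =
      ∑ i, if s(u, v) = s(σ i, σ (i + 1)) then 1 else 0 := fun u hu v hv =>
    xval_cycleVec hN σ fun h => mem_compl.1 hv (h ▸ hu)
  rw [sum_congr rfl fun u hu => sum_congr rfl (h u hu), ← sum_cutWeight]
  simp only [sum_comm (t := (univ : Finset (Fin (N + 1))))]
  refine sum_congr rfl fun i _ => sum_ite_eq_cutWeight U fun h => ?_
  exact Fin.add_one_ne_self hN i (σ.injective h.symm)

/-- The polynomial `γ (b - cut / 2) + ∑ i, d i (2 - deg i)` as a linear function of `(γ, d)`. -/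
def polyMap {n : ℕ} (U : Finset (Fin n)) (b : ℝ) :
    ℝ × (Fin n → ℝ) →ₗ[ℝ] ℝ × (EdgeIdx n → ℝ) where
  toFun q := (q.1 * b + 2 * ∑ i, q.2 i,
    fun e => -(q.1 / 2 * cutWeight U e + vertexWeight q.2 e))
  map_add' q r := by
    ext e
    · simp [sum_add_distrib]; ring
    · obtain ⟨e, he⟩ := e
      induction e with | _ x y =>
      simp [vertexWeight]; ring
  map_smul' t q := by
    ext e
    · simp [← mul_sum]; ring
    · obtain ⟨e, he⟩ := e
      induction e with | _ x y =>
      simp [vertexWeight]; ring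

theorem polyMap_eval {N : ℕ} (hN : 2 ≤ N) (U : Finset (Fin (N + 1))) (b : ℝ)
    (q : ℝ × (Fin (N + 1) → ℝ)) (σ : Equiv.Perm (Fin (N + 1))) :
    (polyMap U b q).1 + ∑ e : EdgeIdx (N + 1), (polyMap U b q).2 e * cycleVec (N + 1) σ e =
      q.1 * (b - runs fun i => chi U (σ i)) := by
  have h := sum_mul_cycleVec hN σ fun e => -(q.1 / 2 * cutWeight U e + vertexWeight q.2 e)
  simp only [sum_neg_distrib, sum_add_distrib, ← mul_sum, sum_cutWeight, sum_vertexWeight] at h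
  simp only [polyMap, LinearMap.coe_mk, AddHom.coe_mk]
  rw [h]
  ring

theorem eq_zero_of_pairwise_add_eq_zero {n : ℕ} (S : Finset (Fin n)) (hS : 3 ≤ #S)
    (d : Fin n → ℝ) (hd : ∀ i ∈ S, ∀ j ∈ S, i ≠ j → d i + d j = 0) : ∀ i ∈ S, d i = 0 := by
  intro i hi
  have hcard : 1 < #(S.erase i) := by rw [card_erase_of_mem hi]; omega
  obtain ⟨j, hj, k, hk, hjk⟩ := one_lt_card.1 hcard
  rw [mem_erase] at hj hk
  have h1 := hd i hi j hj.2 hj.1.symm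
  have h2 := hd i hi k hk.2 hk.1.symm
  have h3 := hd j hj.2 k hk.2 hjk
  linarith

theorem polyMap_injective {n : ℕ} (U : Finset (Fin n)) (b : ℝ) (hU : 3 ≤ #U) (hU' : 3 ≤ #Uᶜ) :
    Function.Injective (polyMap U b) := by
  rw [← LinearMap.ker_eq_bot, LinearMap.ker_eq_bot']
  rintro ⟨γ, d⟩ h
  have hedge : ∀ i j, i ≠ j →
      γ / 2 * (chi U i * (1 - chi U j) + chi U j * (1 - chi U i)) + (d i + d j) = 0 := by
    intro i j hij
    have := congrFun (congrArg Prod.snd h) ⟨s(i, j), by rwa [Sym2.mk_isDiag_iff]⟩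
    simpa [polyMap, cutWeight, vertexWeight, -neg_add_rev, neg_eq_zero] using this
  have h1 : ∀ i ∈ U, d i = 0 := eq_zero_of_pairwise_add_eq_zero U hU d fun i hi j hj hij => by
    simpa [chi, hi, hj] using hedge i j hij
  have h2 : ∀ i ∈ Uᶜ, d i = 0 := eq_zero_of_pairwise_add_eq_zero Uᶜ hU' d fun i hi j hj hij => by
    simpa [chi, mem_compl.1 hi, mem_compl.1 hj] using hedge i j hij
  obtain ⟨u, hu⟩ := card_pos.1 (by omega : 0 < #U)
  obtain ⟨v, hv⟩ := card_pos.1 (by omega : 0 < #Uᶜ)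
  have h3 := hedge u v fun h => mem_compl.1 hv (h ▸ hu)
  rw [h1 u hu, h2 v hv] at h3
  simp [chi, hu, mem_compl.1 hv] at h3
  refine Prod.ext h3 (funext fun i => ?_)
  by_cases hi : i ∈ U
  · exact h1 i hi
  · exact h2 i (mem_compl.2 hi)

/-- **scaling the subtour elimination constraints by `√n`.**
Let `n ≥ 9`, `U ⊂ {1, …, n}`, `|U| = m`, `3 ≤ m ≤ n/2`, `a = √n`, and
`f = a·h_U + (1-a)·𝟙`.  Identifying a polynomial of degree at most `1` on
`ℝ^{n(n-1)/2}` with its coefficient vector `(p₀, (p_e)_e) : ℝ × (EdgeIdx n → ℝ)`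
(so `p(x) = p₀ + Σ_e p_e x_e`), there is a subspace `W` of the space of degree-≤1
polynomials with `dim W ≥ n + 1` such that `(1/|X|) Σ_{x∈X} f(x) p(x)² ≤ 0`
for every `p ∈ W`.  Hence `q_f` has a nonpositive eigenvalue beyond the `n` zero
eigenvalues coming from the degree constraints, so the scaling of `h_U` by `√n`
(with respect to the center `𝟙`) lies outside `P_1` or on its boundary. -/
theorem sqrt_n_scaling_of_subtour_outside_P1
    (n m : ℕ) (hn : 9 ≤ n) (U : Finset (Fin n)) (hUcard : U.card = m)
    (hm3 : 3 ≤ m) (hmn : 2 * m ≤ n) :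
    ∃ W : Submodule ℝ (ℝ × (EdgeIdx n → ℝ)),
      n + 1 ≤ Module.finrank ℝ W ∧
      ∀ p ∈ W,
        ((hamX n).card : ℝ)⁻¹ * ∑ x ∈ hamX n,
            (Real.sqrt n * hU U x + (1 - Real.sqrt n)) *
              (p.1 + ∑ e : EdgeIdx n, p.2 e * x e) ^ 2 ≤ 0 := by
  obtain ⟨N, rfl⟩ : ∃ N, n = N + 1 := ⟨n - 1, by omega⟩
  have hN : 2 ≤ N := by omega
  have hU3 : 3 ≤ #U := by omega
  have hUc : 3 ≤ #Uᶜ := by rw [card_compl, Fintype.card_fin]; omega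
  set a : ℝ := Real.sqrt ((N + 1 : ℕ) : ℝ) with ha
  set n' : ℝ := ((N + 1 : ℕ) : ℝ) with hn'
  set D : ℝ := ((m : ℝ) * (n' - m) + 1 - n') / (n' - 1) with hD
  set v : ℝ := (m : ℝ) * (n' - m) * D / ((n' - 1) * (n' - 2)) with hv
  set b : ℝ := a * v / D + 1 + D with hb
  refine ⟨LinearMap.range (polyMap U b), ?_, ?_⟩
  · rw [LinearMap.finrank_range_of_inj (polyMap_injective U b hU3 hUc)]
    simp [add_comm]
  rintro _ ⟨q, rfl⟩
  obtain ⟨c, hc, hsum⟩ := exists_sum_perm_eq_mul_sum_hamX (N + 1)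
  refine mul_nonpos_of_nonneg_of_nonpos (inv_nonneg.2 (Nat.cast_nonneg _)) ?_
  refine nonpos_of_mul_nonpos_right ?_ hc
  rw [← hsum fun x => (a * hU U x + (1 - a)) *
    ((polyMap U b q).1 + ∑ e : EdgeIdx (N + 1), (polyMap U b q).2 e * x e) ^ 2]
  have hterm : ∀ σ : Equiv.Perm (Fin (N + 1)), (a * hU U (cycleVec (N + 1) σ) + (1 - a)) *
      ((polyMap U b q).1 +
        ∑ e : EdgeIdx (N + 1), (polyMap U b q).2 e * cycleVec (N + 1) σ e) ^ 2 =
      q.1 ^ 2 * ((a * ((runs (fun i => chi U (σ i)) - 1) / D) + (1 - a)) *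
        (b - runs fun i => chi U (σ i)) ^ 2) := fun σ => by
    have hUσ : hU U (cycleVec (N + 1) σ) = (runs (fun i => chi U (σ i)) - 1) / D := by
      rw [hU, sum_xval_cycleVec hN, hUcard, hD, div_div_eq_mul_div, ← hn', ← mul_sub_one,
        div_mul_eq_mul_div, mul_left_comm, mul_div_mul_left _ _ two_ne_zero, mul_comm]
    rw [polyMap_eval hN, hUσ]
    ring
  simp only [hterm, ← mul_sum]
  refine mul_nonpos_of_nonneg_of_nonpos (sq_nonneg _) ?_
  have hn9 : (9 : ℝ) ≤ n' := by rw [hn']; exact_mod_cast hn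
  exact sum_perm_weighted_sq_runs_nonpos (chi U) (fun i => by unfold chi; split_ifs <;> simp)
    n' m a (by simp [hn']) hn9 (by simp [chi, hUcard])
    (by exact_mod_cast hm3) (by rw [hn']; exact_mod_cast hmn) (Real.sqrt_nonneg _)
    (Real.sq_sqrt (by positivity)) D v hD hv
end
end
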